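/- arXiv:2504.06989 — 4 statements merged into one kernel-verified Lean document; each statement's English description precedes it below -/
import Mathlib

section
/- Let γ, λ, μ ∈ ℂ with λ ≠ 2γ, μ ≠ 2γ, and λ + μ ≠ 2γ. Then the Yang operators on (ℂ²)^{⊗3} satisfy the Yang–Baxter equation Y_{1,2}(λ) ∘ Y_{2,3}(λ+μ) ∘ Y_{1,2}(μ) = Y_{2,3}(μ) ∘ Y_{1,2}(λ+μ) ∘ Y_{2,3}(λ). -/
/-- Spin index `{↑,↓}`. -/
inductive Spin : Type
  | up : Spin
  | down : Spin
  deriving DecidableEq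

/-- `(ℂ²)^{⊗3}`, identified with functions `{↑,↓}³ → ℂ`. -/
abbrev V3 : Type := (Fin 3 → Spin) → ℂ

/-- The transposition operator `Π_{j,l}` acting on `(ℂ²)^{⊗3}`. -/
def Pi3 (j l : Fin 3) (w : V3) : V3 := fun a => w (a ∘ Equiv.swap j l)

/-- The Yang operator `Y_{j,l}(λ) = (λΠ_{j,l} - 2γ·Id)/(λ - 2γ)` on `(ℂ²)^{⊗3}`. -/
noncomputable def Y3 (γ : ℂ) (j l : Fin 3) (lam : ℂ) (w : V3) : V3 :=
  fun a => (lam * Pi3 j l w a - 2 * γ * w a) / (lam - 2 * γ)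

/-- The Yang–Baxter equation
`Y_{1,2}(λ) ∘ Y_{2,3}(λ+μ) ∘ Y_{1,2}(μ) = Y_{2,3}(μ) ∘ Y_{1,2}(λ+μ) ∘ Y_{2,3}(λ)`. -/
theorem yang_baxter (γ lam mu : ℂ) (h1 : lam ≠ 2 * γ) (h2 : mu ≠ 2 * γ)
    (h3 : lam + mu ≠ 2 * γ) :
    ∀ w : V3,
      Y3 γ 0 1 lam (Y3 γ 1 2 (lam + mu) (Y3 γ 0 1 mu w)) =
        Y3 γ 1 2 mu (Y3 γ 0 1 (lam + mu) (Y3 γ 1 2 lam w)) := by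
  intro w
  funext a
  have hs : ∀ b : Fin 3 → Spin, (b ∘ Equiv.swap 0 1) ∘ Equiv.swap 0 1 = b := fun b => by
    ext i; simp
  have ht : ∀ b : Fin 3 → Spin, (b ∘ Equiv.swap 1 2) ∘ Equiv.swap 1 2 = b := fun b => by
    ext i; simp
  have hbraid : ((a ∘ Equiv.swap 0 1) ∘ Equiv.swap 1 2) ∘ Equiv.swap 0 1 =
      ((a ∘ Equiv.swap 1 2) ∘ Equiv.swap 0 1) ∘ Equiv.swap (1 : Fin 3) 2 := by
    ext i; fin_cases i <;> rfl
  have d1 := sub_ne_zero.mpr h1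
  have d2 := sub_ne_zero.mpr h2
  have d3 := sub_ne_zero.mpr h3
  simp only [Y3, Pi3, hs, ht, hbraid]
  field_simp
  ring
end

section
/- Let γ, λ ∈ ℂ with λ ≠ 0 and λ ≠ 2γ. Then (Id − Π_{2,3}) ∘ (2Π_{1,2} − Id) ∘ Y_{3,4}(λ) ∘ Y_{2,3}(λ+2γ) applied to I4 equals 0 in (ℂ²)^{⊗4}. -/
/-- `ε(↓,↑) = 1`, `ε(↑,↓) = -1`, `ε(↑,↑) = ε(↓,↓) = 0`. -/
def epsS : Spin → Spin → ℂ
  | Spin.down, Spin.up => 1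
  | Spin.up, Spin.down => -1
  | _, _ => 0

/-- `(ℂ²)^{⊗4}`, identified with functions `{↑,↓}⁴ → ℂ`. -/
abbrev V4 : Type := (Fin 4 → Spin) → ℂ

/-- The transposition operator `Π_{j,l}` acting on `(ℂ²)^{⊗4}`. -/
def Pi4 (j l : Fin 4) (w : V4) : V4 := fun a => w (a ∘ Equiv.swap j l)

/-- The Yang operator `Y_{j,l}(λ) = (λΠ_{j,l} - 2γ·Id)/(λ - 2γ)` on `(ℂ²)^{⊗4}`. -/
noncomputable def Y4 (γ : ℂ) (j l : Fin 4) (lam : ℂ) (w : V4) : V4 :=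
  fun a => (lam * Pi4 j l w a - 2 * γ * w a) / (lam - 2 * γ)

/-- The vector `I4` with components `I4(a1,a2,a3,a4) = ε(a1,a2)·ε(a3,a4)`. -/
def I4 : V4 := fun a => epsS (a 0) (a 1) * epsS (a 2) (a 3)

/-- The Plücker relation for the singlet form `ε`. -/
theorem epsS_plucker (p q r s : Spin) :
    epsS p r * epsS q s = epsS p q * epsS r s + epsS p s * epsS q r := by
  cases p <;> cases q <;> cases r <;> cases s <;> simp [epsS]

theorem epsS_antisymm (p q : Spin) : epsS q p = -epsS p q := by
  cases p <;> cases q <;> simp [epsS]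

/-- Two Yang operators turn the pairing `12|34` into a multiple of the pairing `14|23`. -/
theorem Y4_Y4_I4 {γ lam : ℂ} (h0 : lam ≠ 0) (h2 : lam ≠ 2 * γ) (a : Fin 4 → Spin) :
    Y4 γ 2 3 lam (Y4 γ 1 2 (lam + 2 * γ) I4) a =
      (lam + 2 * γ) / lam * (epsS (a 0) (a 3) * epsS (a 1) (a 2)) := by
  have h2' : lam - 2 * γ ≠ 0 := sub_ne_zero.mpr h2
  simp [Y4, Pi4, I4, Equiv.swap_apply_def]
  rw [epsS_antisymm (a 2) (a 3), epsS_plucker (a 0) (a 1) (a 2) (a 3)]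
  field_simp
  ring

/-- `(Id - Π_{2,3})(2Π_{1,2} - Id) Y_{3,4}(λ) Y_{2,3}(λ+2γ)` annihilates `I4`. -/
theorem annihilation_identity (γ lam : ℂ) (h0 : lam ≠ 0) (h2 : lam ≠ 2 * γ) :
    let w2 : V4 := Y4 γ 2 3 lam (Y4 γ 1 2 (lam + 2 * γ) I4)
    let w3 : V4 := fun a => 2 * Pi4 0 1 w2 a - w2 a
    ∀ a : Fin 4 → Spin, w3 a - Pi4 1 2 w3 a = 0 := by
  intro w2 w3 a
  have hw (b : Fin 4 → Spin) : w2 b =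
      (lam + 2 * γ) / lam * (epsS (b 0) (b 3) * epsS (b 1) (b 2)) :=
    Y4_Y4_I4 h0 h2 b
  simp [w3, Pi4, hw, Equiv.swap_apply_def]
  rw [epsS_antisymm (a 1) (a 2)]
  linear_combination 2 * ((lam + 2 * γ) / lam) * epsS_plucker (a 0) (a 1) (a 2) (a 3)
end

section
/- For every real d ≠ 0, (1/2π)·∫_ℝ exp((d+iy)²)/(d+iy)² dy = 1/√π. -/
open MeasureTheory

lemma ofReal_add_mul_I_ne_zero {d : ℝ} (hd : d ≠ 0) (y : ℝ) :
    (d : ℂ) + y * Complex.I ≠ 0 := fun h ↦ hd (by simpa using congrArg Complex.re h)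

lemma cexp_sq_vertical_eq (d : ℝ) :
    (fun y : ℝ ↦ Complex.exp (((d : ℂ) + y * Complex.I) ^ 2)) =
      fun y : ℝ ↦ Complex.exp (-1 * (y : ℂ) ^ 2 + (2 * d * Complex.I) * y + (d : ℂ) ^ 2) := by
  funext y
  congr 1
  linear_combination (y : ℂ) ^ 2 * Complex.I_sq

lemma integrable_cexp_sq_vertical (d : ℝ) :
    Integrable fun y : ℝ ↦ Complex.exp (((d : ℂ) + y * Complex.I) ^ 2) := by
  rw [cexp_sq_vertical_eq]
  exact integrable_cexp_quadratic' (by simp) _ _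

lemma integral_cexp_sq_vertical (d : ℝ) :
    ∫ y : ℝ, Complex.exp (((d : ℂ) + y * Complex.I) ^ 2) = (Real.sqrt Real.pi : ℝ) := by
  rw [cexp_sq_vertical_eq, integral_cexp_quadratic (by simp)]
  have h : (d : ℂ) ^ 2 - (2 * d * Complex.I) ^ 2 / (4 * -1) = 0 := by
    linear_combination (d : ℂ) ^ 2 * Complex.I_sq
  rw [h, Complex.exp_zero, mul_one, neg_neg, div_one, Real.sqrt_eq_rpow,
    Complex.ofReal_cpow Real.pi_pos.le]
  norm_num

lemma integrable_cexp_sq_vertical_div_pow {d : ℝ} (hd : d ≠ 0) (n : ℕ) :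
    Integrable fun y : ℝ ↦
      Complex.exp (((d : ℂ) + y * Complex.I) ^ 2) / ((d : ℂ) + y * Complex.I) ^ n := by
  simp only [div_eq_mul_inv]
  refine (integrable_cexp_sq_vertical d).mul_bdd (c := (|d| ^ n)⁻¹) ?_ ?_
  · refine (Continuous.inv₀ (by fun_prop) fun y ↦ ?_).aestronglyMeasurable
    exact pow_ne_zero _ (ofReal_add_mul_I_ne_zero hd y)
  · refine Filter.Eventually.of_forall fun y ↦ ?_
    rw [norm_inv, norm_pow]
    have h : |d| ≤ ‖(d : ℂ) + y * Complex.I‖ := by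
      simpa using Complex.abs_re_le_norm ((d : ℂ) + y * Complex.I)
    gcongr

lemma hasDerivAt_cexp_sq_vertical_div {d : ℝ} (hd : d ≠ 0) (y : ℝ) :
    HasDerivAt (fun y : ℝ ↦ Complex.exp (((d : ℂ) + y * Complex.I) ^ 2) /
        ((d : ℂ) + y * Complex.I))
      (Complex.I * (2 * Complex.exp (((d : ℂ) + y * Complex.I) ^ 2) -
        Complex.exp (((d : ℂ) + y * Complex.I) ^ 2) / ((d : ℂ) + y * Complex.I) ^ 2)) y := by
  have hz := ofReal_add_mul_I_ne_zero hd y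
  have h : HasDerivAt (fun y : ℝ ↦ (d : ℂ) + y * Complex.I) Complex.I y := by
    simpa using ((Complex.ofRealCLM.hasDerivAt (x := y)).mul_const Complex.I).const_add (d : ℂ)
  refine ((h.pow 2).cexp.div h hz).congr_deriv ?_
  simp only [Pi.pow_apply]
  field_simp
  ring

/-- The saddle-point Gaussian integral: for real `d ≠ 0`,
`(1/2π)·∫_ℝ exp((d+iy)²)/(d+iy)² dy = 1/√π`. -/
theorem gaussian_contour_integral (d : ℝ) (hd : d ≠ 0) :
    (1 / (2 * Real.pi) : ℂ) *
        ∫ y : ℝ, Complex.exp (((d : ℂ) + y * Complex.I) ^ 2) / ((d : ℂ) + y * Complex.I) ^ 2 =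
      ((1 / Real.sqrt Real.pi : ℝ) : ℂ) := by
  have hE := (integrable_cexp_sq_vertical d).const_mul 2
  have hE₂ := integrable_cexp_sq_vertical_div_pow hd 2
  have h := integral_eq_zero_of_hasDerivAt_of_integrable (hasDerivAt_cexp_sq_vertical_div hd)
    ((hE.sub hE₂).const_mul Complex.I)
    (by simpa using integrable_cexp_sq_vertical_div_pow hd 1)
  rw [integral_const_mul, integral_sub hE hE₂, integral_const_mul, integral_cexp_sq_vertical,
    mul_eq_zero, or_iff_right Complex.I_ne_zero, sub_eq_zero] at h
  rw [← h]
  have hs : (Real.sqrt Real.pi : ℂ) ≠ 0 := by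
    exact_mod_cast (Real.sqrt_pos.2 Real.pi_pos).ne'
  have hp : (Real.pi : ℂ) = (Real.sqrt Real.pi : ℂ) ^ 2 := by
    exact_mod_cast (Real.sq_sqrt Real.pi_pos.le).symm
  have hp₀ : (Real.pi : ℂ) ≠ 0 := by exact_mod_cast Real.pi_ne_zero
  push_cast
  field_simp
  exact hp.symm
end

section
/- For all real numbers 0 < d2 < d1, the absolutely convergent double integral ∫_ℝ ∫_ℝ exp((d1+iy1)² + (d2+iy2)²) / ( ((d1+iy1)+(d2+iy2))² · ((d2+iy2)−(d1+iy1)) ) dy2 dy1 equals −π²/√(2π). -/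
open MeasureTheory

/-- The integral of `exp (s ^ 2 / 2 - s * x)` along a vertical line. -/
theorem integral_cexp_sq_div_two_sub_mul (a x : ℝ) :
    ∫ u : ℝ, Complex.exp (((a : ℂ) + u * Complex.I) ^ 2 / 2 - (a + u * Complex.I) * x) =
      (Real.sqrt (2 * Real.pi) : ℂ) * Complex.exp (-(1 / 2 : ℂ) * x ^ 2) := by
  have h := integral_cexp_quadratic (b := -(1 / 2 : ℂ)) (by norm_num)
    (Complex.I * (a - x)) ((a : ℂ) ^ 2 / 2 - a * x)
  have hpt : ∀ u : ℝ, ((a : ℂ) + u * Complex.I) ^ 2 / 2 - (a + u * Complex.I) * x =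
      -(1 / 2 : ℂ) * u ^ 2 + Complex.I * (a - x) * u + ((a : ℂ) ^ 2 / 2 - a * x) := by
    intro u
    linear_combination (u ^ 2 / 2 : ℂ) * Complex.I_sq
  simp_rw [hpt]
  rw [h]
  congr 1
  · rw [show (Real.pi : ℂ) / -(-(1 / 2)) = ((2 * Real.pi : ℝ) : ℂ) by push_cast; ring,
      Real.sqrt_eq_rpow, Complex.ofReal_cpow (by positivity)]
    norm_num
  · congr 1
    linear_combination ((a - x) ^ 2 / 2 : ℂ) * Complex.I_sq

theorem norm_cexp_sq_div_two (a u : ℝ) :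
    ‖Complex.exp (((a : ℂ) + u * Complex.I) ^ 2 / 2)‖ =
      Real.exp (a ^ 2 / 2) * Real.exp (-(1 / 2) * u ^ 2) := by
  rw [Complex.norm_exp, ← Real.exp_add]
  congr 1
  simp [pow_two]
  ring

theorem add_mul_I_ne_zero {a : ℝ} (ha : 0 < a) (u : ℝ) : (a : ℂ) + u * Complex.I ≠ 0 := by
  intro h
  have := congrArg Complex.re h
  simp at this
  exact ha.ne' this

theorem continuous_cexp_sq_div_two_div_pow {a : ℝ} (ha : 0 < a) (n : ℕ) :
    Continuous fun u : ℝ => Complex.exp (((a : ℂ) + u * Complex.I) ^ 2 / 2) /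
      ((a : ℂ) + u * Complex.I) ^ n :=
  Continuous.div (by fun_prop) (by fun_prop) fun u => pow_ne_zero _ (add_mul_I_ne_zero ha u)

theorem integrable_cexp_sq_div_two_div_pow {a : ℝ} (ha : 0 < a) (n : ℕ) :
    Integrable fun u : ℝ => Complex.exp (((a : ℂ) + u * Complex.I) ^ 2 / 2) /
      ((a : ℂ) + u * Complex.I) ^ n := by
  refine (((integrable_exp_neg_mul_sq (b := 1 / 2) (by norm_num)).const_mul
    (Real.exp (a ^ 2 / 2))).div_const (a ^ n)).mono'
    (continuous_cexp_sq_div_two_div_pow ha n).aestronglyMeasurable (.of_forall fun u => ?_)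
  rw [norm_div, norm_cexp_sq_div_two, norm_pow]
  gcongr
  simpa [abs_of_pos ha] using Complex.abs_re_le_norm ((a : ℂ) + u * Complex.I)

theorem norm_pow_mul_cexp_neg_mul (n : ℕ) (s : ℂ) (x : ℝ) :
    ‖(x : ℂ) ^ n * Complex.exp (-(s * x))‖ = ‖x ^ n * Real.exp (-s.re * x)‖ := by
  simp [Complex.norm_exp]

theorem integrableOn_pow_mul_exp_neg_mul (n : ℕ) {a : ℝ} (ha : 0 < a) :
    IntegrableOn (fun x : ℝ => x ^ n * Real.exp (-a * x)) (Set.Ioi 0) := by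
  simpa using integrableOn_rpow_mul_exp_neg_mul_rpow (p := 1) (s := n) (b := a)
    (by have := n.cast_nonneg (α := ℝ); linarith) one_pos ha

theorem integrableOn_pow_mul_cexp_neg_mul (n : ℕ) {s : ℂ} (hs : 0 < s.re) :
    IntegrableOn (fun x : ℝ => (x : ℂ) ^ n * Complex.exp (-(s * x))) (Set.Ioi 0) :=
  Integrable.mono (integrableOn_pow_mul_exp_neg_mul n hs)
    (Continuous.aestronglyMeasurable (by fun_prop))
    (.of_forall fun x => (norm_pow_mul_cexp_neg_mul n s x).le)

/-- Laplace transform of a natural power. -/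
theorem integral_pow_mul_cexp_neg_mul_Ioi (n : ℕ) {s : ℂ} (hs : 0 < s.re) :
    ∫ x in Set.Ioi (0 : ℝ), (x : ℂ) ^ n * Complex.exp (-(s * x)) =
      n.factorial / s ^ (n + 1) := by
  have hs0 : s ≠ 0 := fun h => by simp [h] at hs
  induction n with
  | zero =>
    have h := integral_exp_mul_complex_Ioi (a := -s) (by simpa using hs) 0
    simp only [pow_zero, one_mul, ← neg_mul, h]
    simp
  | succ n ih =>
    have hderiv : ∀ x ∈ Set.Ici (0 : ℝ),
        HasDerivAt (fun x : ℝ => (x : ℂ) ^ (n + 1) * Complex.exp (-(s * x)))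
          ((n + 1) * ((x : ℂ) ^ n * Complex.exp (-(s * x))) -
            s * ((x : ℂ) ^ (n + 1) * Complex.exp (-(s * x)))) x := by
      intro x _
      have h1 := (hasDerivAt_pow (n + 1) (x : ℂ)).mul
        (((hasDerivAt_id (x : ℂ)).const_mul s).neg.cexp)
      refine h1.comp_ofReal.congr_deriv ?_
      simp
      ring
    have htend : Filter.Tendsto (fun x : ℝ => (x : ℂ) ^ (n + 1) * Complex.exp (-(s * x)))
        Filter.atTop (nhds 0) := by
      rw [tendsto_zero_iff_norm_tendsto_zero]
      simp_rw [norm_pow_mul_cexp_neg_mul]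
      rw [← tendsto_zero_iff_norm_tendsto_zero]
      exact_mod_cast tendsto_rpow_mul_exp_neg_mul_atTop_nhds_zero (n + 1 : ℕ) s.re hs
    have hn := (integrableOn_pow_mul_cexp_neg_mul n hs).const_mul (n + 1 : ℂ)
    have hn1 := (integrableOn_pow_mul_cexp_neg_mul (n + 1) hs).const_mul s
    have h := integral_Ioi_of_hasDerivAt_of_tendsto' hderiv (hn.sub hn1) htend
    rw [integral_sub hn hn1, integral_const_mul, integral_const_mul, ih] at h
    simp only [Complex.ofReal_zero, ne_eq, Nat.succ_ne_zero, not_false_eq_true, zero_pow,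
      zero_mul, sub_zero] at h
    rw [← mul_right_inj' hs0, ← sub_eq_zero.mp h, Nat.factorial_succ]
    push_cast
    field_simp
    ring

/-- The integral of `n! * exp (s ^ 2 / 2) / s ^ (n + 1)` along a vertical line in the right
half plane, as a Gaussian moment on the half line. -/
theorem integral_cexp_sq_div_two_div_pow {a : ℝ} (ha : 0 < a) (n : ℕ) :
    ∫ u : ℝ, n.factorial * (Complex.exp (((a : ℂ) + u * Complex.I) ^ 2 / 2) /
      ((a : ℂ) + u * Complex.I) ^ (n + 1)) =
    Real.sqrt (2 * Real.pi) *
      ∫ x in Set.Ioi (0 : ℝ), (x : ℂ) ^ n * Complex.exp (-(1 / 2 : ℂ) * x ^ 2) := by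
  have hlap : ∀ u : ℝ, n.factorial * (Complex.exp (((a : ℂ) + u * Complex.I) ^ 2 / 2) /
      ((a : ℂ) + u * Complex.I) ^ (n + 1)) = ∫ x in Set.Ioi (0 : ℝ),
        Complex.exp (((a : ℂ) + u * Complex.I) ^ 2 / 2) *
          ((x : ℂ) ^ n * Complex.exp (-(((a : ℂ) + u * Complex.I) * x))) := by
    intro u
    rw [integral_const_mul, integral_pow_mul_cexp_neg_mul_Ioi n (by simpa using ha)]
    ring
  simp_rw [hlap]
  rw [integral_integral_swap, ← integral_const_mul]
  · refine integral_congr_ae (.of_forall fun x => ?_)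
    have := congrArg ((x : ℂ) ^ n * ·) (integral_cexp_sq_div_two_sub_mul a x)
    simp only [← integral_const_mul] at this
    simp only [mul_left_comm _ ((x : ℂ) ^ n), ← Complex.exp_add, ← sub_eq_add_neg]
    exact this
  · refine ((((integrable_exp_neg_mul_sq (b := 1 / 2) (by norm_num)).const_mul
      (Real.exp (a ^ 2 / 2)))).mul_prod (integrableOn_pow_mul_exp_neg_mul n ha)).mono
      (Continuous.aestronglyMeasurable (by unfold Function.uncurry; fun_prop))
      (.of_forall fun p => le_of_eq ?_)
    rw [Function.uncurry, norm_mul, norm_cexp_sq_div_two, norm_pow_mul_cexp_neg_mul]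
    simp

theorem integral_cexp_sq_div_two_div_sq {a : ℝ} (ha : 0 < a) :
    ∫ u : ℝ, Complex.exp (((a : ℂ) + u * Complex.I) ^ 2 / 2) /
      ((a : ℂ) + u * Complex.I) ^ 2 = Real.sqrt (2 * Real.pi) := by
  have h := integral_cexp_sq_div_two_div_pow ha 1
  have hm := integral_mul_cexp_neg_mul_sq (b := 1 / 2) (by norm_num)
  simp only [Nat.factorial_one, Nat.cast_one, one_mul, pow_one, one_add_one_eq_two] at h
  rw [h, hm]
  norm_num

theorem integral_cexp_sq_div_two_div {a : ℝ} (ha : 0 < a) :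
    ∫ u : ℝ, Complex.exp (((a : ℂ) + u * Complex.I) ^ 2 / 2) /
      ((a : ℂ) + u * Complex.I) = Real.pi := by
  have h := integral_cexp_sq_div_two_div_pow ha 0
  have hm := congrArg (fun r : ℝ => (r : ℂ)) (integral_gaussian_Ioi (1 / 2))
  simp only [← integral_complex_ofReal] at hm
  push_cast at hm
  simp only [Nat.factorial_zero, Nat.cast_one, one_mul, pow_zero, zero_add, pow_one] at h
  rw [h, hm, show Real.pi / (1 / 2) = 2 * Real.pi by ring, ← mul_div_assoc, ← Complex.ofReal_mul,
    Real.mul_self_sqrt (by positivity)]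
  push_cast
  ring

theorem integrable_comp_two_mul_add {f : ℝ → ℂ} (hf : Integrable f) (w : ℝ) :
    Integrable fun y : ℝ => f (2 * y + w) :=
  (hf.comp_add_right w).comp_mul_left' two_ne_zero

theorem integral_comp_two_mul_add {E : Type*} [NormedAddCommGroup E] [NormedSpace ℝ E]
    (f : ℝ → E) (w : ℝ) : ∫ y : ℝ, f (2 * y + w) = (2 : ℝ)⁻¹ • ∫ u : ℝ, f u := by
  rw [Measure.integral_comp_mul_left (fun y => f (y + w)) 2, integral_add_right_eq_self f w]
  norm_num

theorem integrable_comp_two_mul_add_mul {f g : ℝ → ℂ} (hf : Integrable f) (hg : Integrable g)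
    (hfc : Continuous f) (hgc : Continuous g) :
    Integrable fun p : ℝ × ℝ => f (2 * p.1 + p.2) * g p.2 := by
  refine (integrable_prod_iff' (Continuous.aestronglyMeasurable (by fun_prop))).2
    ⟨.of_forall fun w => (integrable_comp_two_mul_add hf w).mul_const (g w), ?_⟩
  simp only [norm_mul, integral_mul_const, integral_comp_two_mul_add fun u => ‖f u‖]
  exact hg.norm.const_mul _

theorem integrable_comp_add_mul_comp_sub {f g : ℝ → ℂ} (hf : Integrable f) (hg : Integrable g)
    (hfc : Continuous f) (hgc : Continuous g) :
    Integrable fun p : ℝ × ℝ => f (p.1 + p.2) * g (p.2 - p.1) := by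
  have h := (measurePreserving_prod_sub (volume : Measure ℝ)
    (volume : Measure ℝ)).integrable_comp_of_integrable
    (integrable_comp_two_mul_add_mul hf hg hfc hgc)
  refine h.congr (.of_forall fun p => ?_)
  simp only [Function.comp]
  ring_nf

theorem integral_integral_comp_add_mul_comp_sub {f g : ℝ → ℂ} (hf : Integrable f)
    (hg : Integrable g) (hfc : Continuous f) (hgc : Continuous g) :
    ∫ x : ℝ, ∫ y : ℝ, f (x + y) * g (y - x) = (∫ u, f u) * (∫ v, g v) / 2 := by
  have hshift : ∀ x : ℝ, ∫ y : ℝ, f (x + y) * g (y - x) = ∫ w : ℝ, f (2 * x + w) * g w := by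
    intro x
    rw [← integral_add_right_eq_self (fun y => f (x + y) * g (y - x)) x]
    refine integral_congr_ae (.of_forall fun w => ?_)
    ring_nf
  simp_rw [hshift]
  rw [integral_integral_swap (integrable_comp_two_mul_add_mul hf hg hfc hgc)]
  simp only [integral_mul_const, integral_comp_two_mul_add f, integral_const_mul]
  simp
  ring


/-- The double saddle-point integral: for `0 < d2 < d1`, the absolutely convergent integral
`∫∫ exp((d1+iy1)² + (d2+iy2)²) / (((d1+iy1)+(d2+iy2))²·((d2+iy2)-(d1+iy1))) dy2 dy1`
equals `-π²/√(2π)`. -/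
theorem double_gaussian_contour_integral (d1 d2 : ℝ) (h2 : 0 < d2) (h12 : d2 < d1) :
    Integrable (fun p : ℝ × ℝ =>
      Complex.exp (((d1 : ℂ) + p.1 * Complex.I) ^ 2 + ((d2 : ℂ) + p.2 * Complex.I) ^ 2) /
        ((((d1 : ℂ) + p.1 * Complex.I) + ((d2 : ℂ) + p.2 * Complex.I)) ^ 2 *
          (((d2 : ℂ) + p.2 * Complex.I) - ((d1 : ℂ) + p.1 * Complex.I)))) ∧
    (∫ y1 : ℝ, ∫ y2 : ℝ,
        Complex.exp (((d1 : ℂ) + y1 * Complex.I) ^ 2 + ((d2 : ℂ) + y2 * Complex.I) ^ 2) /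
          ((((d1 : ℂ) + y1 * Complex.I) + ((d2 : ℂ) + y2 * Complex.I)) ^ 2 *
            (((d2 : ℂ) + y2 * Complex.I) - ((d1 : ℂ) + y1 * Complex.I)))) =
      ((-(Real.pi ^ 2) / Real.sqrt (2 * Real.pi) : ℝ) : ℂ) := by
  have ha : 0 < d1 + d2 := by linarith
  have hb : 0 < d1 - d2 := sub_pos.2 h12
  set f : ℝ → ℂ := fun u => Complex.exp ((((d1 + d2 : ℝ) : ℂ) + u * Complex.I) ^ 2 / 2) /
    (((d1 + d2 : ℝ) : ℂ) + u * Complex.I) ^ 2 with hf_def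
  set g : ℝ → ℂ := fun u => Complex.exp ((((d1 - d2 : ℝ) : ℂ) + u * Complex.I) ^ 2 / 2) /
    (((d1 - d2 : ℝ) : ℂ) + u * Complex.I) with hg_def
  have hf : Integrable f := integrable_cexp_sq_div_two_div_pow ha 2
  have hfc : Continuous f := continuous_cexp_sq_div_two_div_pow ha 2
  have hg : Integrable g := by
    simpa only [pow_one] using integrable_cexp_sq_div_two_div_pow hb 1
  have hgc : Continuous g := by
    simpa only [pow_one] using continuous_cexp_sq_div_two_div_pow hb 1
  have hg' : Integrable fun v => -g (-v) := hg.comp_neg.neg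
  have hgc' : Continuous fun v => -g (-v) := by fun_prop
  have hfactor : ∀ y1 y2 : ℝ,
      Complex.exp (((d1 : ℂ) + y1 * Complex.I) ^ 2 + ((d2 : ℂ) + y2 * Complex.I) ^ 2) /
          ((((d1 : ℂ) + y1 * Complex.I) + ((d2 : ℂ) + y2 * Complex.I)) ^ 2 *
            (((d2 : ℂ) + y2 * Complex.I) - ((d1 : ℂ) + y1 * Complex.I))) =
        f (y1 + y2) * -g (-(y2 - y1)) := by
    intro y1 y2
    rw [hf_def, hg_def, ← div_neg, div_mul_div_comm, ← Complex.exp_add]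
    push_cast
    ring_nf
  simp_rw [hfactor]
  refine ⟨integrable_comp_add_mul_comp_sub hf hg' hfc hgc', ?_⟩
  rw [integral_integral_comp_add_mul_comp_sub hf hg' hfc hgc', integral_neg,
    integral_neg_eq_self g, integral_cexp_sq_div_two_div_sq ha, integral_cexp_sq_div_two_div hb]
  have hsq : Real.sqrt (2 * Real.pi) * Real.sqrt (2 * Real.pi) = 2 * Real.pi :=
    Real.mul_self_sqrt (by positivity)
  have hne : Real.sqrt (2 * Real.pi) ≠ 0 := (Real.sqrt_pos.2 (by positivity)).ne'
  norm_cast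
  rw [eq_div_iff hne]
  linear_combination (-Real.pi / 2) * hsq
end
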